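/- Under hypotheses (H1)–(H2), any weak solution g of the Smoluchowski coagulation equation on [0,T) is mass-conserving: ∫₀^∞ ζ g(ζ,t) dζ = ∫₀^∞ ζ g^{in}(ζ) dζ for all t ∈ (0,T). -/

import Mathlib

open MeasureTheory

/-- The moment weight `ζ ^ (-2β) + ζ`. -/
noncomputable def momentWeight (β ζ : ℝ) : ℝ := ζ ^ (-(2 * β)) + ζ

/-- The identity on `(0, ∞)`, truncated at height `N`. -/
noncomputable def truncId (N ζ : ℝ) : ℝ := min |ζ| N

/-- The tail of `momentWeight β ζ * h ζ` beyond `N / 2`. -/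
noncomputable def weightedTail (β N : ℝ) (h : ℝ → ℝ) (ζ : ℝ) : ℝ :=
  (Set.Ioi (N / 2)).indicator (fun ζ => momentWeight β ζ * h ζ) ζ

lemma measurable_momentWeight (β : ℝ) : Measurable (momentWeight β) := by
  unfold momentWeight; fun_prop

lemma measurable_truncId (N : ℝ) : Measurable (truncId N) := by
  unfold truncId; fun_prop

lemma self_le_momentWeight (β : ℝ) {ζ : ℝ} (hζ : 0 < ζ) : ζ ≤ momentWeight β ζ :=
  le_add_of_nonneg_left (Real.rpow_nonneg hζ.le _)

lemma momentWeight_pos (β : ℝ) {ζ : ℝ} (hζ : 0 < ζ) : 0 < momentWeight β ζ :=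
  hζ.trans_le (self_le_momentWeight β hζ)

lemma rpow_neg_le_momentWeight {β ζ : ℝ} (hβ : 0 < β) (hζ : 0 < ζ) (h1 : ζ < 1) :
    ζ ^ (-β) ≤ momentWeight β ζ :=
  (Real.rpow_le_rpow_of_exponent_ge hζ h1.le (by linarith)).trans
    (le_add_of_nonneg_right hζ.le)

lemma truncId_of_pos (N : ℝ) {ζ : ℝ} (hζ : 0 < ζ) : truncId N ζ = min ζ N := by
  rw [truncId, abs_of_pos hζ]

lemma abs_truncId_le {N : ℝ} (hN : 0 ≤ N) (ζ : ℝ) : |truncId N ζ| ≤ N := by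
  rw [truncId, abs_of_nonneg (le_min (abs_nonneg ζ) hN)]
  exact min_le_right _ _

lemma abs_truncId_le_self {N : ℝ} (hN : 0 ≤ N) {ζ : ℝ} (hζ : 0 < ζ) : |truncId N ζ| ≤ ζ := by
  rw [truncId_of_pos N hζ, abs_of_nonneg (le_min hζ.le hN)]
  exact min_le_left _ _

lemma tendsto_truncId {ζ : ℝ} (hζ : 0 < ζ) :
    Filter.Tendsto (fun n : ℕ => truncId n ζ) Filter.atTop (nhds ζ) := by
  refine tendsto_const_nhds.congr' ?_
  filter_upwards [tendsto_natCast_atTop_atTop.eventually (Filter.eventually_ge_atTop ζ)] with n hn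
  rw [truncId_of_pos _ hζ, min_eq_left hn]

lemma abs_truncId_add_sub_le {N ζ η : ℝ} (hN : 0 ≤ N) (hζ : 0 < ζ) (hη : 0 < η) :
    |truncId N (ζ + η) - truncId N ζ - truncId N η| ≤ min ζ η := by
  rw [truncId_of_pos N hζ, truncId_of_pos N hη, truncId_of_pos N (add_pos hζ hη), abs_le]
  rcases min_cases ζ N with h1 | h1 <;> rcases min_cases η N with h2 | h2 <;>
  rcases min_cases (ζ + η) N with h3 | h3 <;> rcases min_cases ζ η with h4 | h4 <;>
  constructor <;> linarith

lemma truncId_add_sub_eq_zero {N ζ η : ℝ} (hζ : 0 < ζ) (hη : 0 < η) (h : ζ + η ≤ N) :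
    truncId N (ζ + η) - truncId N ζ - truncId N η = 0 := by
  rw [truncId_of_pos N hζ, truncId_of_pos N hη, truncId_of_pos N (add_pos hζ hη),
    min_eq_left h, min_eq_left (by linarith), min_eq_left (by linarith)]
  ring

lemma min_mul_kernel_le {β k : ℝ} (hβ : 0 < β) (hk : 0 < k) {Ψ : ℝ → ℝ → ℝ}
    (hΨsym : ∀ ζ ∈ Set.Ioi (0:ℝ), ∀ η ∈ Set.Ioi (0:ℝ), Ψ ζ η = Ψ η ζ)
    (hΨ1 : ∀ ζ ∈ Set.Ioo (0:ℝ) 1, ∀ η ∈ Set.Ioo (0:ℝ) 1, Ψ ζ η ≤ k * (ζ * η) ^ (-β))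
    (hΨ2 : ∀ ζ ∈ Set.Ioo (0:ℝ) 1, ∀ η ∈ Set.Ioi (1:ℝ), Ψ ζ η ≤ k * η * ζ ^ (-β))
    (hΨ3 : ∀ ζ ∈ Set.Ioi (1:ℝ), ∀ η ∈ Set.Ioi (1:ℝ), Ψ ζ η ≤ k * (ζ + η))
    {ζ η : ℝ} (hζ : 0 < ζ) (hη : 0 < η) (hζ1 : ζ ≠ 1) (hη1 : η ≠ 1) :
    min ζ η * Ψ ζ η ≤ 2 * k * (momentWeight β ζ * momentWeight β η) := by
  wlog hle : ζ ≤ η generalizing ζ η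
  · rw [min_comm, hΨsym ζ hζ η hη, mul_comm (momentWeight β ζ)]
    exact this hη hζ hη1 hζ1 (le_of_not_ge hle)
  rw [min_eq_left hle]
  have hwζ := momentWeight_pos β hζ
  have hwη := momentWeight_pos β hη
  have hww := mul_pos hk (mul_pos hwζ hwη)
  rcases lt_or_gt_of_ne hζ1 with h1 | h1
  · have hΨ : Ψ ζ η ≤ k * (momentWeight β ζ * momentWeight β η) := by
      have hrζ := rpow_neg_le_momentWeight hβ hζ h1
      rcases lt_or_gt_of_ne hη1 with h2 | h2
      · refine (hΨ1 ζ ⟨hζ, h1⟩ η ⟨hη, h2⟩).trans ?_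
        rw [Real.mul_rpow hζ.le hη.le]
        have hrη := rpow_neg_le_momentWeight hβ hη h2
        have := Real.rpow_nonneg hη.le (-β)
        gcongr
      · refine (hΨ2 ζ ⟨hζ, h1⟩ η h2).trans ?_
        rw [mul_assoc, mul_comm η]
        have := self_le_momentWeight β hη
        gcongr
    calc ζ * Ψ ζ η ≤ ζ * (k * (momentWeight β ζ * momentWeight β η)) := by gcongr
      _ ≤ 2 * k * (momentWeight β ζ * momentWeight β η) := by nlinarith
  · have h2 : 1 < η := h1.trans_le hle
    have hζw := self_le_momentWeight β hζ
    have hηw := self_le_momentWeight β hη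
    calc ζ * Ψ ζ η ≤ ζ * (k * (ζ + η)) := by gcongr; exact hΨ3 ζ h1 η h2
      _ ≤ ζ * (k * (η + η)) := by gcongr
      _ = 2 * k * (ζ * η) := by ring
      _ ≤ 2 * k * (momentWeight β ζ * momentWeight β η) := by gcongr

lemma aestronglyMeasurable_of_momentWeight_mul {β : ℝ} {h : ℝ → ℝ}
    (hh : IntegrableOn (fun ζ => momentWeight β ζ * h ζ) (Set.Ioi 0)) :
    AEStronglyMeasurable h (volume.restrict (Set.Ioi 0)) := by
  refine ((measurable_momentWeight β).inv.aestronglyMeasurable.mul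
    hh.aestronglyMeasurable).congr ?_
  filter_upwards [ae_restrict_mem measurableSet_Ioi] with ζ hζ
  exact inv_mul_cancel_left₀ (momentWeight_pos β hζ).ne' _

lemma integrableOn_id_mul {β : ℝ} {h : ℝ → ℝ}
    (hh : IntegrableOn (fun ζ => momentWeight β ζ * h ζ) (Set.Ioi 0)) :
    IntegrableOn (fun ζ => ζ * h ζ) (Set.Ioi 0) := by
  refine Integrable.mono hh (measurable_id.aestronglyMeasurable.mul
    (aestronglyMeasurable_of_momentWeight_mul hh)) ?_
  filter_upwards [ae_restrict_mem measurableSet_Ioi] with ζ hζ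
  rw [norm_mul, norm_mul, Real.norm_of_nonneg (momentWeight_pos β hζ).le,
    Real.norm_of_nonneg (le_of_lt hζ)]
  exact mul_le_mul_of_nonneg_right (self_le_momentWeight β hζ) (norm_nonneg _)

section Tail

variable {β : ℝ} {h : ℝ → ℝ}

lemma integrableOn_weightedTail (N : ℝ)
    (hh : IntegrableOn (fun ζ => momentWeight β ζ * h ζ) (Set.Ioi 0)) :
    IntegrableOn (weightedTail β N h) (Set.Ioi 0) :=
  Integrable.indicator hh measurableSet_Ioi

lemma weightedTail_nonneg (N : ℝ) (hnn : ∀ ζ ∈ Set.Ioi (0:ℝ), 0 ≤ h ζ) {ζ : ℝ} (hζ : 0 < ζ) :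
    0 ≤ weightedTail β N h ζ :=
  Set.indicator_apply_nonneg fun _ => mul_nonneg (momentWeight_pos β hζ).le (hnn ζ hζ)

lemma weightedTail_le (N : ℝ) (hnn : ∀ ζ ∈ Set.Ioi (0:ℝ), 0 ≤ h ζ) {ζ : ℝ} (hζ : 0 < ζ) :
    weightedTail β N h ζ ≤ momentWeight β ζ * h ζ :=
  Set.indicator_apply_le' (fun _ => le_rfl)
    fun _ => mul_nonneg (momentWeight_pos β hζ).le (hnn ζ hζ)

lemma tendsto_integral_weightedTail
    (hh : IntegrableOn (fun ζ => momentWeight β ζ * h ζ) (Set.Ioi 0))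
    (hnn : ∀ ζ ∈ Set.Ioi (0:ℝ), 0 ≤ h ζ) :
    Filter.Tendsto (fun n : ℕ => ∫ ζ in Set.Ioi (0:ℝ), weightedTail β n h ζ) Filter.atTop
      (nhds 0) := by
  suffices Filter.Tendsto (fun n : ℕ => ∫ ζ in Set.Ioi (0:ℝ), weightedTail β n h ζ) Filter.atTop
      (nhds (∫ _ in Set.Ioi (0:ℝ), (0:ℝ))) by simpa using this
  refine tendsto_integral_of_dominated_convergence _
    (fun n => (integrableOn_weightedTail n hh).aestronglyMeasurable) hh (fun n => ?_) ?_
  · filter_upwards [ae_restrict_mem measurableSet_Ioi] with ζ hζ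
    rw [Real.norm_of_nonneg (weightedTail_nonneg _ hnn hζ)]
    exact weightedTail_le _ hnn hζ
  · refine .of_forall fun ζ => tendsto_const_nhds.congr' ?_
    filter_upwards [tendsto_natCast_atTop_atTop.eventually
      (Filter.eventually_ge_atTop (2 * ζ))] with n hn
    rw [weightedTail, Set.indicator_of_notMem]
    simp only [Set.mem_Ioi, not_lt]
    linarith

lemma coagulation_integrand_le {N k : ℝ} (hN : 0 ≤ N) {Ψ : ℝ → ℝ → ℝ} {ζ η : ℝ}
    (hζ : 0 < ζ) (hη : 0 < η) (hΨnn : 0 ≤ Ψ ζ η)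
    (hΨ : min ζ η * Ψ ζ η ≤ 2 * k * (momentWeight β ζ * momentWeight β η))
    (hk : 0 < k) (hnn : ∀ ζ ∈ Set.Ioi (0:ℝ), 0 ≤ h ζ) :
    ‖(truncId N (ζ + η) - truncId N ζ - truncId N η) * Ψ ζ η * h ζ * h η‖ ≤
      2 * k * (weightedTail β N h ζ * (momentWeight β η * h η) +
        (momentWeight β ζ * h ζ) * weightedTail β N h η) := by
  have hhζ := hnn ζ hζ
  have hhη := hnn η hη
  have hPζ := mul_nonneg (momentWeight_pos β hζ).le hhζ
  have hPη := mul_nonneg (momentWeight_pos β hη).le hhη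
  have hTζ := weightedTail_nonneg (β := β) N hnn hζ
  have hTη := weightedTail_nonneg (β := β) N hnn hη
  by_cases hle : ζ + η ≤ N
  · rw [truncId_add_sub_eq_zero hζ hη hle]
    simp only [zero_mul, norm_zero]
    positivity
  have key : ‖(truncId N (ζ + η) - truncId N ζ - truncId N η) * Ψ ζ η * h ζ * h η‖ ≤
      2 * k * ((momentWeight β ζ * h ζ) * (momentWeight β η * h η)) := by
    rw [norm_mul, norm_mul, norm_mul, Real.norm_of_nonneg hhζ, Real.norm_of_nonneg hhη,
      Real.norm_of_nonneg hΨnn]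
    calc _ ≤ min ζ η * Ψ ζ η * h ζ * h η := by
          gcongr; exact abs_truncId_add_sub_le hN hζ hη
      _ ≤ 2 * k * (momentWeight β ζ * momentWeight β η) * h ζ * h η := by gcongr
      _ = _ := by ring
  refine key.trans ?_
  gcongr
  rcases le_or_gt ζ (N / 2) with h1 | h1
  · have h2 : η ∈ Set.Ioi (N / 2) := by simp only [Set.mem_Ioi]; linarith
    have e : weightedTail β N h η = momentWeight β η * h η := Set.indicator_of_mem h2 _
    rw [e]
    exact le_add_of_nonneg_left (mul_nonneg hTζ hPη)
  · have e : weightedTail β N h ζ = momentWeight β ζ * h ζ := Set.indicator_of_mem h1 _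
    rw [e]
    exact le_add_of_nonneg_right (mul_nonneg hPζ hTη)

/-- The coagulation operator tested against `truncId N` is controlled by the weighted tail;
measurability of the kernel plays no role. -/
lemma norm_coagulation_truncId_le {N k : ℝ} (hN : 0 ≤ N) (hk : 0 < k) {Ψ : ℝ → ℝ → ℝ}
    (hΨnn : ∀ ζ ∈ Set.Ioi (0:ℝ), ∀ η ∈ Set.Ioi (0:ℝ), 0 ≤ Ψ ζ η)
    (hΨ : ∀ ζ η : ℝ, 0 < ζ → 0 < η → ζ ≠ 1 → η ≠ 1 →
      min ζ η * Ψ ζ η ≤ 2 * k * (momentWeight β ζ * momentWeight β η))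
    (hh : IntegrableOn (fun ζ => momentWeight β ζ * h ζ) (Set.Ioi 0))
    (hnn : ∀ ζ ∈ Set.Ioi (0:ℝ), 0 ≤ h ζ) :
    ‖∫ ζ in Set.Ioi (0:ℝ), ∫ η in Set.Ioi (0:ℝ),
        (truncId N (ζ + η) - truncId N ζ - truncId N η) * Ψ ζ η * h ζ * h η‖ ≤
      4 * k * (∫ ζ in Set.Ioi (0:ℝ), momentWeight β ζ * h ζ) *
        ∫ ζ in Set.Ioi (0:ℝ), weightedTail β N h ζ := by
  have hT := integrableOn_weightedTail N hh
  set I := ∫ ζ in Set.Ioi (0:ℝ), momentWeight β ζ * h ζ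
  set J := ∫ ζ in Set.Ioi (0:ℝ), weightedTail β N h ζ
  have hne : ∀ᵐ ζ ∂(volume.restrict (Set.Ioi (0:ℝ))), ζ ≠ 1 :=
    ae_restrict_of_ae (Measure.ae_ne volume 1)
  have hb : Integrable (fun ζ => 2 * k * (weightedTail β N h ζ * I +
      (momentWeight β ζ * h ζ) * J)) (volume.restrict (Set.Ioi 0)) :=
    ((hT.mul_const I).add (hh.mul_const J)).const_mul _
  calc _ ≤ ∫ ζ in Set.Ioi (0:ℝ), 2 * k * (weightedTail β N h ζ * I +
        (momentWeight β ζ * h ζ) * J) := by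
        refine norm_integral_le_of_norm_le hb ?_
        filter_upwards [ae_restrict_mem measurableSet_Ioi, hne] with ζ hζ hζ1
        have hb' : Integrable (fun η => 2 * k * (weightedTail β N h ζ *
            (momentWeight β η * h η) + (momentWeight β ζ * h ζ) * weightedTail β N h η))
            (volume.restrict (Set.Ioi 0)) :=
          ((hh.const_mul _).add (hT.const_mul _)).const_mul _
        refine (norm_integral_le_of_norm_le hb' ?_).trans_eq ?_
        · filter_upwards [ae_restrict_mem measurableSet_Ioi, hne] with η hη hη1
          exact coagulation_integrand_le hN hζ hη (hΨnn ζ hζ η hη)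
            (hΨ ζ η hζ hη hζ1 hη1) hk hnn
        · rw [integral_const_mul, integral_add (hh.const_mul _) (hT.const_mul _),
            integral_const_mul, integral_const_mul]
    _ = 4 * k * I * J := by
        rw [integral_const_mul, integral_add (hT.mul_const I) (hh.mul_const J),
          integral_mul_const, integral_mul_const]
        ring

end Tail

lemma tendsto_integral_mul_truncId {h : ℝ → ℝ}
    (hm : AEStronglyMeasurable h (volume.restrict (Set.Ioi 0)))
    (hh : IntegrableOn (fun ζ => ζ * h ζ) (Set.Ioi 0)) :
    Filter.Tendsto (fun n : ℕ => ∫ ζ in Set.Ioi (0:ℝ), h ζ * truncId n ζ) Filter.atTop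
      (nhds (∫ ζ in Set.Ioi (0:ℝ), ζ * h ζ)) := by
  refine tendsto_integral_of_dominated_convergence _
    (fun n => hm.mul (measurable_truncId n).aestronglyMeasurable) hh.norm (fun n => ?_) ?_
  · filter_upwards [ae_restrict_mem measurableSet_Ioi] with ζ hζ
    rw [norm_mul, norm_mul, mul_comm, Real.norm_of_nonneg (le_of_lt hζ)]
    exact mul_le_mul_of_nonneg_right (abs_truncId_le_self n.cast_nonneg hζ) (norm_nonneg _)
  · filter_upwards [ae_restrict_mem measurableSet_Ioi] with ζ hζ
    rw [mul_comm ζ]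
    exact (tendsto_truncId hζ).const_mul _

/-- Bounded convergence to zero, without assuming the integrands measurable: Bochner integrals of
non-integrable functions vanish. -/
lemma tendsto_integral_zero_of_bounded {α : Type*} [MeasurableSpace α] {μ : Measure α}
    [IsFiniteMeasure μ] {F : ℕ → α → ℝ} {M : ℝ} (hM : ∀ n, ∀ᵐ s ∂μ, ‖F n s‖ ≤ M)
    (hF : ∀ᵐ s ∂μ, Filter.Tendsto (fun n => F n s) Filter.atTop (nhds 0)) :
    Filter.Tendsto (fun n => ∫ s, F n s ∂μ) Filter.atTop (nhds 0) := by
  classical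
  let G : ℕ → α → ℝ := fun n => if Integrable (F n) μ then F n else 0
  have hG : ∀ n, ∫ s, F n s ∂μ = ∫ s, G n s ∂μ := fun n => by
    by_cases hn : Integrable (F n) μ
    · simp only [G, if_pos hn]
    · simp [G, if_neg hn, integral_undef hn]
  have hGF : ∀ n s, ‖G n s‖ ≤ ‖F n s‖ := fun n s => by
    by_cases hn : Integrable (F n) μ <;> simp [G, hn]
  simp only [hG]
  rw [← integral_zero α ℝ (μ := μ)]
  refine tendsto_integral_of_dominated_convergence (fun _ => M) (fun n => ?_)
    (integrable_const M) (fun n => ?_) ?_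
  · by_cases hn : Integrable (F n) μ
    · simp only [G, if_pos hn]; exact hn.aestronglyMeasurable
    · simp only [G, if_neg hn]; exact aestronglyMeasurable_zero
  · filter_upwards [hM n] with s hs using (hGF n s).trans hs
  · filter_upwards [hF] with s hs
    exact squeeze_zero_norm (fun n => hGF n s) (tendsto_zero_iff_norm_tendsto_zero.mp hs)

theorem stmt_17 (β k T : ℝ) (hβ : 0 < β) (hk : 0 < k) (hT : 0 < T)
    (Ψ : ℝ → ℝ → ℝ) (g : ℝ → ℝ → ℝ) (gin : ℝ → ℝ)
    (hΨnn : ∀ ζ ∈ Set.Ioi (0:ℝ), ∀ η ∈ Set.Ioi (0:ℝ), 0 ≤ Ψ ζ η)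
    (hΨsym : ∀ ζ ∈ Set.Ioi (0:ℝ), ∀ η ∈ Set.Ioi (0:ℝ), Ψ ζ η = Ψ η ζ)
    (hΨ1 : ∀ ζ ∈ Set.Ioo (0:ℝ) 1, ∀ η ∈ Set.Ioo (0:ℝ) 1, Ψ ζ η ≤ k * (ζ * η) ^ (-β))
    (hΨ2 : ∀ ζ ∈ Set.Ioo (0:ℝ) 1, ∀ η ∈ Set.Ioi (1:ℝ), Ψ ζ η ≤ k * η * ζ ^ (-β))
    (hΨ3 : ∀ ζ ∈ Set.Ioi (1:ℝ), ∀ η ∈ Set.Ioi (1:ℝ), Ψ ζ η ≤ k * (ζ + η))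
    (hginnn : ∀ ζ ∈ Set.Ioi (0:ℝ), 0 ≤ gin ζ)
    (hgin : IntegrableOn (fun ζ => (ζ ^ (-(2*β)) + ζ) * gin ζ) (Set.Ioi 0))
    (hgnn : ∀ t ∈ Set.Ico (0:ℝ) T, ∀ ζ ∈ Set.Ioi (0:ℝ), 0 ≤ g ζ t)
    (hgbd : ∃ C : ℝ, ∀ t ∈ Set.Ico (0:ℝ) T,
      IntegrableOn (fun ζ => (ζ ^ (-(2*β)) + ζ) * g ζ t) (Set.Ioi 0) ∧
      (∫ ζ in Set.Ioi (0:ℝ), (ζ ^ (-(2*β)) + ζ) * g ζ t) ≤ C)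
    (hweak : ∀ ω : ℝ → ℝ, Measurable ω → (∃ C : ℝ, ∀ ζ : ℝ, |ω ζ| ≤ C) →
      ∀ t ∈ Set.Ioo (0:ℝ) T,
        (∫ ζ in Set.Ioi (0:ℝ), (g ζ t - gin ζ) * ω ζ)
          = (1/2) * ∫ s in (0:ℝ)..t, ∫ ζ in Set.Ioi (0:ℝ), ∫ η in Set.Ioi (0:ℝ),
              (ω (ζ + η) - ω ζ - ω η) * Ψ ζ η * g ζ s * g η s) :
    ∀ t ∈ Set.Ioo (0:ℝ) T,
      (∫ ζ in Set.Ioi (0:ℝ), ζ * g ζ t) = ∫ ζ in Set.Ioi (0:ℝ), ζ * gin ζ := by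
  obtain ⟨C, hC⟩ := hgbd
  intro t ht
  have htIco : t ∈ Set.Ico (0:ℝ) T := ⟨ht.1.le, ht.2⟩
  have hgt : IntegrableOn (fun ζ => momentWeight β ζ * g ζ t) (Set.Ioi 0) := (hC t htIco).1
  have hg0 : IntegrableOn (fun ζ => momentWeight β ζ * gin ζ) (Set.Ioi 0) := hgin
  have hζg := integrableOn_id_mul hgt
  have hζg0 := integrableOn_id_mul hg0
  have hlhs := tendsto_integral_mul_truncId (h := fun ζ => g ζ t - gin ζ)
    ((aestronglyMeasurable_of_momentWeight_mul hgt).sub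
      (aestronglyMeasurable_of_momentWeight_mul hg0))
    ((hζg.sub hζg0).congr (.of_forall fun ζ => (mul_sub ζ (g ζ t) (gin ζ)).symm))
  let F : ℕ → ℝ → ℝ := fun n s => ∫ ζ in Set.Ioi (0:ℝ), ∫ η in Set.Ioi (0:ℝ),
    (truncId n (ζ + η) - truncId n ζ - truncId n η) * Ψ ζ η * g ζ s * g η s
  have hF : ∀ n : ℕ, ∀ s ∈ Set.Ico (0:ℝ) T, ‖F n s‖ ≤
      4 * k * (∫ ζ in Set.Ioi (0:ℝ), momentWeight β ζ * g ζ s) *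
        ∫ ζ in Set.Ioi (0:ℝ), weightedTail β n (fun ζ => g ζ s) ζ := fun n s hs =>
    norm_coagulation_truncId_le n.cast_nonneg hk hΨnn
      (fun ζ η hζ hη hζ1 hη1 => min_mul_kernel_le hβ hk hΨsym hΨ1 hΨ2 hΨ3 hζ hη hζ1 hη1)
      (hC s hs).1 (hgnn s hs)
  have hmem : ∀ᵐ s ∂(volume.restrict (Set.Ioc 0 t)), s ∈ Set.Ico (0:ℝ) T := by
    filter_upwards [ae_restrict_mem measurableSet_Ioc] with s hs
    exact ⟨hs.1.le, hs.2.trans_lt ht.2⟩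
  have hrhs : Filter.Tendsto (fun n : ℕ => ∫ s in Set.Ioc 0 t, F n s) Filter.atTop (nhds 0) := by
    refine tendsto_integral_zero_of_bounded (M := 4 * k * C * C) (fun n => ?_) ?_
    · filter_upwards [hmem] with s hs
      have hIC : (∫ ζ in Set.Ioi (0:ℝ), momentWeight β ζ * g ζ s) ≤ C := (hC s hs).2
      have hJ0 : 0 ≤ ∫ ζ in Set.Ioi (0:ℝ), weightedTail β n (fun ζ => g ζ s) ζ :=
        setIntegral_nonneg measurableSet_Ioi fun ζ hζ => weightedTail_nonneg _ (hgnn s hs) hζ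
      have hJI : (∫ ζ in Set.Ioi (0:ℝ), weightedTail β n (fun ζ => g ζ s) ζ) ≤
          ∫ ζ in Set.Ioi (0:ℝ), momentWeight β ζ * g ζ s :=
        setIntegral_mono_on (integrableOn_weightedTail _ (hC s hs).1) (hC s hs).1
          measurableSet_Ioi fun ζ hζ => weightedTail_le _ (hgnn s hs) hζ
      have hC0 : 0 ≤ C := hJ0.trans (hJI.trans hIC)
      refine (hF n s hs).trans ?_
      gcongr
      exact hJI.trans hIC
    · filter_upwards [hmem] with s hs
      refine squeeze_zero_norm (fun n => hF n s hs) ?_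
      simpa using (tendsto_integral_weightedTail (hC s hs).1 (hgnn s hs)).const_mul
        (4 * k * ∫ ζ in Set.Ioi (0:ℝ), momentWeight β ζ * g ζ s)
  have heq : ∀ n : ℕ, (∫ ζ in Set.Ioi (0:ℝ), (g ζ t - gin ζ) * truncId n ζ) =
      (1/2) * ∫ s in Set.Ioc 0 t, F n s := fun n => by
    rw [hweak (truncId n) (measurable_truncId n) ⟨n, abs_truncId_le n.cast_nonneg⟩ t ht,
      intervalIntegral.integral_of_le ht.1.le]
  have hzero : (∫ ζ in Set.Ioi (0:ℝ), ζ * (g ζ t - gin ζ)) = 0 := by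
    refine tendsto_nhds_unique hlhs ?_
    simp only [heq]
    simpa using hrhs.const_mul (1/2 : ℝ)
  simp only [mul_sub] at hzero
  rw [integral_sub hζg hζg0] at hzero
  exact sub_eq_zero.mp hzero
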